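/- Norm identity for N²₊ in Type IIA geometry (pointwise form): let N be a φ₀-compatible Nijenhuis-type tensor on ℝ⁶. Then Σ_{i,j} ((N²₊)_{ij})² = (3/16)·(|N|²)². -/

import Mathlib

noncomputable section

/-- The underlying vector space `ℝ⁶`. -/
abbrev V6 : Type := Fin 6 → ℝ

/-- The standard basis of `ℝ⁶`. -/
def e6 (i : Fin 6) : V6 := fun j => if j = i then (1 : ℝ) else 0

/-- The standard complex structure `J` with `Je₁=e₂, Je₂=−e₁, Je₃=e₄, Je₄=−e₃, Je₅=e₆,
Je₆=−e₅`. -/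
def Jstd (x : V6) : V6 := ![-x 1, x 0, -x 3, x 2, -x 5, x 4]

/-- For a trilinear map `T` antisymmetric in its last two arguments and a 3-form `μ`,
the quadrilinear map `T ⊠ μ` (indices raised with the standard Euclidean metric). -/
def boxt (T μ : V6 → V6 → V6 → ℝ) (x y z w : V6) : ℝ :=
  ∑ p : Fin 6,
    (T (e6 p) x y * μ (e6 p) z w + T (e6 p) z w * μ (e6 p) x y
      - T (e6 p) x z * μ (e6 p) y w - T (e6 p) y w * μ (e6 p) x z
      + T (e6 p) x w * μ (e6 p) y z + T (e6 p) y z * μ (e6 p) x w)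

/-- A 3-form, viewed as a trilinear function of vectors. -/
def ap3 (φ : AlternatingMap ℝ V6 ℝ (Fin 3)) : V6 → V6 → V6 → ℝ :=
  fun x y z => φ ![x, y, z]

/-- The elementary 3-form `e^a ∧ e^b ∧ e^c`, as a trilinear function. -/
def elem3 (a b c : Fin 6) (x y z : V6) : ℝ :=
  Matrix.det !![x a, x b, x c; y a, y b, y c; z a, z b, z c]

/-- The model 3-form `φ₀ = e¹∧e³∧e⁵ − e¹∧e⁴∧e⁶ − e²∧e⁴∧e⁵ − e²∧e³∧e⁶`. -/
def phi0 (x y z : V6) : ℝ :=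
  elem3 0 2 4 x y z - elem3 0 3 5 x y z - elem3 1 3 4 x y z - elem3 1 2 5 x y z

/-- Components `N_{ijk} = N(e_i, e_j, e_k)`. -/
def Nc (N : V6 →ₗ[ℝ] V6 →ₗ[ℝ] V6 →ₗ[ℝ] ℝ) (i j k : Fin 6) : ℝ := N (e6 i) (e6 j) (e6 k)

/-- `(N²₊)_{ij} = Σ_{p,k} N_{pki} N_{pkj}`. -/
def N2p (N : V6 →ₗ[ℝ] V6 →ₗ[ℝ] V6 →ₗ[ℝ] ℝ) (i j : Fin 6) : ℝ :=
  ∑ p : Fin 6, ∑ k : Fin 6, Nc N p k i * Nc N p k j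

/-- `(N²₋)_{ij} = Σ_{p,k} N_{kpi} N_{pkj}`. -/
def N2m (N : V6 →ₗ[ℝ] V6 →ₗ[ℝ] V6 →ₗ[ℝ] ℝ) (i j : Fin 6) : ℝ :=
  ∑ p : Fin 6, ∑ k : Fin 6, Nc N k p i * Nc N p k j

/-- `|N|² = Σ_{i,p,k} N_{ipk}²`. -/
def normNsq (N : V6 →ₗ[ℝ] V6 →ₗ[ℝ] V6 →ₗ[ℝ] ℝ) : ℝ :=
  ∑ i : Fin 6, ∑ p : Fin 6, ∑ k : Fin 6, (Nc N i p k) ^ 2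

theorem Jstd_Jstd (x : V6) : Jstd (Jstd x) = -x := by
  ext i
  fin_cases i <;> simp [Jstd]

theorem e6_one : e6 1 = Jstd (e6 0) := by
  ext i
  fin_cases i <;> simp [e6, Jstd]

theorem e6_three : e6 3 = Jstd (e6 2) := by
  ext i
  fin_cases i <;> simp [e6, Jstd]

theorem e6_five : e6 5 = Jstd (e6 4) := by
  ext i
  fin_cases i <;> simp [e6, Jstd]

/-- Norm identity for `N²₊` in Type IIA geometry: for a φ₀-compatible
Nijenhuis-type tensor `N`, `Σ_{i,j} ((N²₊)_{ij})² = (3/16)·(|N|²)²`. -/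
theorem nijenhuis_N2plus_norm (N : V6 →ₗ[ℝ] V6 →ₗ[ℝ] V6 →ₗ[ℝ] ℝ)
    (hanti : ∀ x y z : V6, N x y z = -N x z y)
    (htype1 : ∀ x y z : V6, N (Jstd x) y z = N x (Jstd y) z)
    (htype2 : ∀ x y z : V6, N x (Jstd y) z = N x y (Jstd z))
    (hbianchi : ∀ x y z : V6, N x y z + N z x y + N y z x = 0)
    (hcompat : ∀ x y z w : V6,
      (∑ p : Fin 6, (N (e6 p) x y * phi0 (e6 p) z w + N (e6 p) z w * phi0 (e6 p) x y)) = 0) :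
    (∑ i : Fin 6, ∑ j : Fin 6, (N2p N i j) ^ 2) = (3 / 16 : ℝ) * (normNsq N) ^ 2 := by
  have hself (x y : V6) : N x y y = 0 := by linarith [hanti x y y]
  have hselfJ (x y : V6) : N x y (Jstd y) = 0 := by
    linarith [hanti x y (Jstd y), htype2 x y y]
  have hantiJ (x y z : V6) : N x y (Jstd z) = -N x z (Jstd y) := by
    rw [hanti, htype2]
  have hJ (x y z : V6) : N (Jstd x) y z = N x y (Jstd z) := by rw [htype1, htype2]
  have compat (i j k l : Fin 6) := hcompat (e6 i) (e6 j) (e6 k) (e6 l)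
  have compat2424 := compat 2 4 2 4
  have compat4040 := compat 4 0 4 0
  have compat0202 := compat 0 2 0 2
  have compat2440 := compat 2 4 4 0
  have compat2402 := compat 2 4 0 2
  have compat4002 := compat 4 0 0 2
  have compat2540 := compat 2 5 4 0
  have compat2502 := compat 2 5 0 2
  have compat4102 := compat 4 1 0 2
  have bianchi025 := hbianchi (e6 0) (e6 2) (Jstd (e6 4))
  simp [Fin.sum_univ_six, phi0, elem3, Matrix.det_fin_three, e6]
    at compat2424 compat4040 compat0202 compat2440 compat2402 compat4002 compat2540 compat2502 compat4102
  simp only [e6_one, e6_three, e6_five, hJ] at compat2540 compat2502 compat4102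
  have anti20 (x : V6) : N x (e6 2) (e6 0) = -N x (e6 0) (e6 2) := hanti _ _ _
  have anti40 (x : V6) : N x (e6 4) (e6 0) = -N x (e6 0) (e6 4) := hanti _ _ _
  have anti42 (x : V6) : N x (e6 4) (e6 2) = -N x (e6 2) (e6 4) := hanti _ _ _
  have antiJ20 (x : V6) : N x (e6 2) (Jstd (e6 0)) = -N x (e6 0) (Jstd (e6 2)) := hantiJ _ _ _
  have antiJ40 (x : V6) : N x (e6 4) (Jstd (e6 0)) = -N x (e6 0) (Jstd (e6 4)) := hantiJ _ _ _
  have antiJ42 (x : V6) : N x (e6 4) (Jstd (e6 2)) = -N x (e6 2) (Jstd (e6 4)) := hantiJ _ _ _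
  rw [anti40, neg_eq_zero] at compat4040
  rw [hJ, htype2, antiJ40] at bianchi025
  have eq224 : N (e6 2) (e6 2) (e6 4) = N (e6 0) (e6 0) (e6 4) := by linarith [anti40 (e6 0)]
  have eq424 : N (e6 4) (e6 2) (e6 4) = -N (e6 0) (e6 0) (e6 2) := by linarith
  have eq404 : N (e6 4) (e6 0) (e6 4) = N (e6 2) (e6 0) (e6 2) := by linarith [anti40 (e6 4)]
  have eq225 : N (e6 2) (e6 2) (Jstd (e6 4)) = -N (e6 0) (e6 0) (Jstd (e6 4)) := by
    linarith [antiJ40 (e6 0)]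
  have eq425 : N (e6 4) (e6 2) (Jstd (e6 4)) = N (e6 0) (e6 0) (Jstd (e6 2)) := by linarith
  have eq405 : N (e6 4) (e6 0) (Jstd (e6 4)) = -N (e6 2) (e6 0) (Jstd (e6 2)) := by
    linarith [antiJ40 (e6 4)]
  have eq205 : N (e6 2) (e6 0) (Jstd (e6 4)) =
      N (e6 0) (e6 2) (Jstd (e6 4)) + N (e6 4) (e6 0) (Jstd (e6 2)) := by linarith
  -- The eight remaining components parametrise a trace-free skew-Hermitian matrix.
  simp only [N2p, normNsq, Nc, Fin.sum_univ_six, e6_one, e6_three, e6_five, hJ, htype2,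
    Jstd_Jstd, map_neg, hself, hselfJ, anti20, anti40, anti42, antiJ20, antiJ40, antiJ42,
    compat2424, compat4040, compat0202, eq224, eq424, eq404, eq225, eq425, eq405, eq205,
    neg_zero, mul_zero, zero_mul, add_zero, zero_add, neg_neg]
  ring
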